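/- arXiv:2211.04541 — 3 statements merged into one kernel-verified Lean document; each statement's English description precedes it below -/
import Mathlib

section
/- Fix reals 0 < a < b and let Y ⊊ X be any two spaces of the chain (★) with X ≠ ℓ^∞. Then there exist a set I with card(I) = 𝔠 and a linearly independent family (F^k)_{k∈I} of dense vector subspaces of X such that the vector subspace spanned by ⋃_{k∈I} F^k is contained in (X \ Y) ∪ {0}. In particular, there is uncountably infinite algebraic genericity for X \ Y in X. -/
open Filter Topology

noncomputable section

/-- The topology generated by the open balls of a distance function `d`.
When `d` is an actual metric this is precisely the metric topology. -/
def topOfDist {α : Type*} (d : α → α → ℝ) : TopologicalSpace α :=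
  TopologicalSpace.generateFrom {S | ∃ x r, S = {y | d x y < r}}

/-- The space `ℓ^p`, `0 < p < ∞`, of complex sequences. -/
def lpSet (p : ℝ) : Set (ℕ → ℂ) := {x | Summable fun n => ‖x n‖ ^ p}

/-- The metric `d^p` of `ℓ^p`: the norm metric for `p ≥ 1`, and
`d^p(x,y) = Σ |x n - y n| ^ p` for `0 < p < 1`. -/
def dlp (p : ℝ) (x y : ℕ → ℂ) : ℝ :=
  if 1 ≤ p then (∑' n, ‖x n - y n‖ ^ p) ^ (1 / p) else ∑' n, ‖x n - y n‖ ^ p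

/-- The space `⋂_{q > p} ℓ^q`. -/
def interLp (p : ℝ) : Set (ℕ → ℂ) := ⋂ q ∈ Set.Ioi p, lpSet q

/-- The metric `δ^p` of `⋂_{q > p} ℓ^q`, built from the strictly decreasing
sequence `p_k = p + 1/k → p` (`k ≥ 1`). -/
def dinter (p : ℝ) (x y : ℕ → ℂ) : ℝ :=
  ∑' k : ℕ, ((1 : ℝ) / 2) ^ (k + 1) *
    (dlp (p + 1 / ((k : ℝ) + 1)) x y / (1 + dlp (p + 1 / ((k : ℝ) + 1)) x y))

/-- The space `ℓ^∞` of bounded complex sequences. -/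
def linfSet : Set (ℕ → ℂ) := {x | ∃ C : ℝ, ∀ n, ‖x n‖ ≤ C}

/-- The sup metric `d^∞`. -/
def dsup (x y : ℕ → ℂ) : ℝ := ⨆ n, ‖x n - y n‖

/-- The space `c₀` of complex sequences tending to `0`. -/
def c0Set : Set (ℕ → ℂ) := {x | Tendsto x atTop (𝓝 0)}

/-- The space `c₀₀` of finitely supported complex sequences. -/
def c00Set : Set (ℕ → ℂ) := {x | (Function.support x).Finite}

/-- `A^∞(𝔻)`, viewed as a sequence space: `n^k x(n) → 0` for every `k`. -/
def AinfSet : Set (ℕ → ℂ) :=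
  {x | ∀ k : ℕ, Tendsto (fun n : ℕ => (n : ℂ) ^ k * x n) atTop (𝓝 0)}

/-- `H(𝔻)`, viewed as a sequence space via Taylor coefficients:
`limsup |x n| ^ (1/n) ≤ 1`. -/
def HdSet : Set (ℕ → ℂ) :=
  {x | Filter.limsup (fun n => ‖x n‖ ^ (1 / (n : ℝ))) atTop ≤ 1}

/-- The open unit disk. -/
def unitBall : Set ℂ := Metric.ball 0 1

/-- The holomorphic function on the unit disk whose Taylor coefficients are `x`. -/
def taylorSum (x : ℕ → ℂ) : ↥unitBall → ℂ := fun z => ∑' n, x n * (z : ℂ) ^ n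

/-- The topology on `H(𝔻)` of uniform convergence on the compact subsets of the
unit disk, transported via the Taylor-coefficient identification. -/
def HdTopology : TopologicalSpace ↥HdSet :=
  TopologicalSpace.induced
    (fun x : ↥HdSet =>
      UniformOnFun.ofFun {K : Set ↥unitBall | IsCompact K} (taylorSum x.1))
    inferInstance

/-- Indices of the chain (★):
`c₀₀ ⊊ A^∞(𝔻) ⊊ ⋂_{p>0} ℓ^p ⊊ ℓ^a ⊊ ⋂_{q>a} ℓ^q ⊊ ℓ^b ⊊ ⋂_{p>b} ℓ^p ⊊ c₀ ⊊ ℓ^∞ ⊊ H(𝔻) ⊊ ℂ^ℕ`. -/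
inductive ChainIdx : Type
  | c00 | Ainf | inter0 | la | interA | lb | interB | c0 | linf | Hd | all

/-- The underlying set of sequences of each space of the chain (★). -/
def chainCarrier (a b : ℝ) : ChainIdx → Set (ℕ → ℂ)
  | .c00 => c00Set
  | .Ainf => AinfSet
  | .inter0 => interLp 0
  | .la => lpSet a
  | .interA => interLp a
  | .lb => lpSet b
  | .interB => interLp b
  | .c0 => c0Set
  | .linf => linfSet
  | .Hd => HdSet
  | .all => Set.univ

/-- The topology of each space of the chain (★): `c₀₀`, `c₀`, `ℓ^∞` carry the sup
metric, `ℓ^p` carries `d^p`, `⋂_{q>p} ℓ^q` carries `δ^p`, `A^∞(𝔻)` is a subspace of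
`ℂ^ℕ`, `H(𝔻)` carries uniform convergence on compacta, `ℂ^ℕ` the product topology. -/
def chainTopology (a b : ℝ) : (i : ChainIdx) → TopologicalSpace ↥(chainCarrier a b i)
  | .c00 => topOfDist fun x y => dsup x.1 y.1
  | .Ainf => instTopologicalSpaceSubtype
  | .inter0 => topOfDist fun x y => dinter 0 x.1 y.1
  | .la => topOfDist fun x y => dlp a x.1 y.1
  | .interA => topOfDist fun x y => dinter a x.1 y.1
  | .lb => topOfDist fun x y => dlp b x.1 y.1
  | .interB => topOfDist fun x y => dinter b x.1 y.1
  | .c0 => topOfDist fun x y => dsup x.1 y.1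
  | .linf => topOfDist fun x y => dsup x.1 y.1
  | .Hd => HdTopology
  | .all => instTopologicalSpaceSubtype


/-! ### Combinatorics of the supports -/

/-- Colouring of `ℕ`, constant on dyadic blocks, each colour being used on infinitely many. -/
def dyadicColour (m : ℕ) : ℕ := (Nat.unpair (Nat.log 2 m)).1

/-- The code of the initial segment of length `n` of `σ`. -/
def prefixCode (σ : ℕ → Bool) (n : ℕ) : ℕ := Encodable.encode ((List.range n).map σ)

/-- The integers whose colour codes an initial segment of `σ`. -/
def branchSet (σ : ℕ → Bool) : Set ℕ := {m | dyadicColour m ∈ Set.range (prefixCode σ)}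

lemma exists_dyadicColour_block (t N : ℕ) :
    ∃ k, N ≤ k ∧ ∀ m ∈ Finset.Ico (2 ^ k) (2 ^ (k + 1)), dyadicColour m = t := by
  refine ⟨Nat.pair t N, Nat.right_le_pair t N, fun m hm => ?_⟩
  rw [Finset.mem_Ico] at hm
  rw [dyadicColour, Nat.log_eq_of_pow_le_of_lt_pow hm.1 hm.2, Nat.unpair_pair]

lemma frequently_two_pow_dyadicColour (t : ℕ) : ∃ᶠ k in atTop, dyadicColour (2 ^ k) = t := by
  rw [frequently_atTop]
  intro N
  obtain ⟨k, hk, h⟩ := exists_dyadicColour_block t N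
  exact ⟨k, hk, h _ (by simp [pow_succ])⟩

lemma frequently_dyadicColour (t : ℕ) : ∃ᶠ m in atTop, dyadicColour m = t :=
  (tendsto_pow_atTop_atTop_of_one_lt (one_lt_two : (1 : ℕ) < 2)).frequently
    (frequently_two_pow_dyadicColour t)

lemma prefixCode_eq {σ τ : ℕ → Bool} {n k : ℕ} (h : prefixCode σ n = prefixCode τ k) :
    ∀ i < n, σ i = τ i := by
  have h' := Encodable.encode_injective h
  have hl : n = k := by simpa using congrArg List.length h'
  subst hl
  intro i hi
  exact List.map_inj_left.1 h' i (List.mem_range.2 hi)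

lemma exists_colour_separating (σ : ℕ → Bool) (s : Finset (ℕ → Bool)) (hs : σ ∉ s) :
    ∃ t, (∀ m, dyadicColour m = t → m ∈ branchSet σ) ∧
      ∀ τ ∈ s, ∀ m, dyadicColour m = t → m ∉ branchSet τ := by
  have h1 : ∀ τ ∈ s, ∃ i, σ i ≠ τ i := fun τ hτ => by
    by_contra! h
    exact hs (funext h ▸ hτ)
  choose! i hi using h1
  refine ⟨prefixCode σ (s.sup i + 1), fun m hm => ⟨_, hm.symm⟩, ?_⟩
  rintro τ hτ m hm ⟨k, hk⟩
  exact hi τ hτ (prefixCode_eq (hm.symm.trans hk.symm) _ (Nat.lt_succ_of_le (Finset.le_sup hτ)))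

lemma not_summable_of_div_le {f : ℕ → ℝ} {C : ℝ} (hC : 0 < C) {t : ℕ}
    (h : ∀ᶠ m in atTop, dyadicColour m = t → C / m ≤ f m) : ¬ Summable f := by
  intro hs
  obtain ⟨N, hN⟩ := eventually_atTop.1 h
  obtain ⟨s, hs⟩ := summable_iff_vanishing_norm.1 hs (C / 2) (by positivity)
  obtain ⟨k, hk, hkt⟩ := exists_dyadicColour_block t (N + s.sup id + 1)
  have hlt : k < 2 ^ k := Nat.lt_two_pow_self
  have hdisj : Disjoint (Finset.Ico (2 ^ k) (2 ^ (k + 1))) s := by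
    rw [Finset.disjoint_left]
    intro m hm hms
    have := Finset.le_sup (f := id) hms
    simp only [Finset.mem_Ico, id] at hm this
    omega
  have h1 := hs _ hdisj
  have h2 : ∑ m ∈ Finset.Ico (2 ^ k) (2 ^ (k + 1)), C / (2 ^ (k + 1) : ℝ) ≤
      ∑ m ∈ Finset.Ico (2 ^ k) (2 ^ (k + 1)), f m := by
    refine Finset.sum_le_sum fun m hm => ?_
    have hm' := Finset.mem_Ico.1 hm
    have hm0 : 0 < m := by omega
    refine le_trans ?_ (hN m (by omega) (hkt m hm))
    have : (m : ℝ) ≤ 2 ^ (k + 1) := by exact_mod_cast hm'.2.le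
    gcongr
  have h3 : ∑ m ∈ Finset.Ico (2 ^ k) (2 ^ (k + 1)), C / (2 ^ (k + 1) : ℝ) = C / 2 := by
    have : 2 ^ (k + 1) - 2 ^ k = 2 ^ k := by rw [pow_succ]; omega
    rw [Finset.sum_const, Nat.card_Ico, this, nsmul_eq_mul, pow_succ]
    push_cast
    field_simp
  have h4 := (le_abs_self _).trans_lt h1
  linarith

/-! ### The general construction -/

/-- The first `n` terms of `x`, plus the restriction to `A` of `g / (n + 1)`. -/
def approximant (x g : ℕ → ℂ) (n : ℕ) (A : Set ℕ) : ℕ → ℂ :=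
  (Set.Iio n).indicator x + A.indicator ((1 / ((n : ℂ) + 1)) • g)

lemma norm_sub_approximant_le (x g : ℕ → ℂ) (n : ℕ) (A : Set ℕ) (m : ℕ) :
    ‖x m - approximant x g n A m‖ ≤ (Set.Ici n).indicator (fun m => ‖x m‖) m
      + 1 / ((n : ℝ) + 1) * ‖g m‖ := by
  have h1 : ‖A.indicator ((1 / ((n : ℂ) + 1)) • g) m‖ ≤ 1 / ((n : ℝ) + 1) * ‖g m‖ := by
    refine (norm_indicator_le_norm_self _ _).trans (le_of_eq ?_)
    have : ‖(n : ℂ) + 1‖ = (n : ℝ) + 1 := by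
      rw [← Nat.cast_succ, Complex.norm_natCast, Nat.cast_succ]
    simp [this]
  have h2 : x m - (Set.Iio n).indicator x m = (Set.Ici n).indicator x m := by
    by_cases h : m < n
    · simp [h]
    · simp [h, not_lt.1 h]
  rw [approximant, Pi.add_apply, ← sub_sub, h2]
  refine (norm_sub_le _ _).trans (add_le_add (le_of_eq ?_) h1)
  exact norm_indicator_eq_indicator_norm _ _

lemma norm_sub_approximant_le_add (x g : ℕ → ℂ) (n : ℕ) (A : Set ℕ) (m : ℕ) :
    ‖x m - approximant x g n A m‖ ≤ ‖x m‖ + ‖g m‖ := by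
  refine (norm_sub_approximant_le x g n A m).trans (add_le_add ?_ ?_)
  · exact Set.indicator_le_self' (fun _ _ => norm_nonneg _) m
  · refine mul_le_of_le_one_left (norm_nonneg _) ?_
    rw [div_le_one (by positivity)]
    linarith [n.cast_nonneg (α := ℝ)]

lemma tendsto_norm_sub_approximant (x g : ℕ → ℂ) (A : ℕ → Set ℕ) (m : ℕ) :
    Tendsto (fun n => ‖x m - approximant x g n (A n) m‖) atTop (𝓝 0) := by
  have h : Tendsto (fun n : ℕ => 1 / ((n : ℝ) + 1) * ‖g m‖) atTop (𝓝 0) := by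
    simpa using tendsto_one_div_add_atTop_nhds_zero_nat.mul_const ‖g m‖
  refine squeeze_zero' (Eventually.of_forall fun _ => norm_nonneg _) ?_ h
  filter_upwards [eventually_gt_atTop m] with n hn
  refine (norm_sub_approximant_le x g n (A n) m).trans (le_of_eq ?_)
  simp [hn]

/-- Parameters of the generators: the subspace, the sequence approximated, the truncation. -/
abbrev GenIdx : Type := (ℕ → Bool) × (ℕ → ℂ) × ℕ

lemma exists_injective_branch : ∃ κ : GenIdx → (ℕ → Bool), Function.Injective κ := by
  have h : Cardinal.mk GenIdx ≤ Cardinal.mk (ℕ → Bool) := by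
    simp [Cardinal.mk_prod]
  obtain ⟨e⟩ := h
  exact ⟨e, e.injective⟩

/-- The generator attached to an index. -/
def generator (κ : GenIdx → (ℕ → Bool)) (h : (ℕ → ℂ) → ℕ → ℂ) (s : GenIdx) : ℕ → ℂ :=
  approximant s.2.1 (h s.2.1) s.2.2 (branchSet (κ s))

lemma generator_apply_of_mem {κ : GenIdx → (ℕ → Bool)} {h : (ℕ → ℂ) → ℕ → ℂ} {s : GenIdx} {m : ℕ}
    (hm : s.2.2 ≤ m) (hA : m ∈ branchSet (κ s)) :
    generator κ h s m = 1 / ((s.2.2 : ℂ) + 1) * h s.2.1 m := by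
  simp [generator, approximant, hm, hA]

lemma generator_apply_of_notMem {κ : GenIdx → (ℕ → Bool)} {h : (ℕ → ℂ) → ℕ → ℂ} {s : GenIdx}
    {m : ℕ} (hm : s.2.2 ≤ m) (hA : m ∉ branchSet (κ s)) : generator κ h s m = 0 := by
  simp [generator, approximant, hm, hA]

/-- `v` eventually agrees with a nonzero multiple of `g` on some colour. -/
def AgreesOnColour (v g : ℕ → ℂ) : Prop :=
  ∃ (t : ℕ) (c : ℂ), c ≠ 0 ∧ ∀ᶠ m in atTop, dyadicColour m = t → v m = c * g m

lemma agreesOnColour_linearCombination {κ : GenIdx → (ℕ → Bool)} (hκ : Function.Injective κ)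
    (h : (ℕ → ℂ) → ℕ → ℂ) (c : GenIdx →₀ ℂ) {s : GenIdx} (hs : s ∈ c.support) :
    AgreesOnColour (Finsupp.linearCombination ℂ (generator κ h) c) (h s.2.1) := by
  classical
  obtain ⟨t, ht1, ht2⟩ := exists_colour_separating (κ s) ((c.support.erase s).image κ) (by
    simp only [Finset.mem_image, Finset.mem_erase, not_exists, not_and, and_imp]
    exact fun u hu _ hsu => hu (hκ hsu))
  refine ⟨t, c s * (1 / ((s.2.2 : ℂ) + 1)), ?_, ?_⟩
  · exact mul_ne_zero (Finsupp.mem_support_iff.1 hs)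
      (one_div_ne_zero (Nat.cast_add_one_ne_zero _))
  filter_upwards [eventually_ge_atTop (c.support.sup fun u => u.2.2)] with m hm hmt
  have hle : ∀ u ∈ c.support, u.2.2 ≤ m := fun u hu =>
    (Finset.le_sup (f := fun u : GenIdx => u.2.2) hu).trans hm
  rw [Finsupp.linearCombination_apply, Finsupp.sum, Finset.sum_apply,
    Finset.sum_eq_single_of_mem s hs]
  · rw [Pi.smul_apply, generator_apply_of_mem (hle s hs) (ht1 m hmt), smul_eq_mul, mul_assoc]
  · intro u hu hus
    rw [Pi.smul_apply, generator_apply_of_notMem (hle u hu), smul_zero]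
    exact ht2 _ (Finset.mem_image_of_mem κ (Finset.mem_erase.2 ⟨hus, hu⟩)) m hmt

/-- Continuum many independent dense subspaces of `X` spanning a subspace of `(X \ Y) ∪ {0}`. -/
def HasGenericFamily (X Y : Set (ℕ → ℂ)) (τ : TopologicalSpace X) : Prop :=
  ∃ (I : Type) (F : I → Submodule ℂ (ℕ → ℂ)),
    Cardinal.mk I = Cardinal.continuum ∧
    (∀ k, (F k : Set (ℕ → ℂ)) ⊆ X) ∧
    (∀ k, @Dense X τ (Subtype.val ⁻¹' (F k : Set (ℕ → ℂ)))) ∧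
    (∀ (J : Finset I) (v : I → (ℕ → ℂ)), (∀ k ∈ J, v k ∈ F k) →
      (∑ k ∈ J, v k) = 0 → ∀ k ∈ J, v k = 0) ∧
    (∀ v : ℕ → ℂ, v ∈ (⨆ k, F k : Submodule ℂ (ℕ → ℂ)) → v ≠ 0 → v ∈ X ∧ v ∉ Y)

lemma HasGenericFamily.mono {X Y Z : Set (ℕ → ℂ)} {τ : TopologicalSpace X}
    (h : HasGenericFamily X Y τ) (hZ : Z ⊆ Y) : HasGenericFamily X Z τ := by
  obtain ⟨I, F, h1, h2, h3, h4, h5⟩ := h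
  exact ⟨I, F, h1, h2, h3, h4, fun v hv h0 => ⟨(h5 v hv h0).1, fun hz => (h5 v hv h0).2 (hZ hz)⟩⟩

/-- The subspace spanned by the generators with first parameter `k`. -/
def genSpan (κ : GenIdx → (ℕ → Bool)) (h : (ℕ → ℂ) → ℕ → ℂ) (k : ℕ → Bool) :
    Submodule ℂ (ℕ → ℂ) :=
  Submodule.span ℂ (generator κ h '' {s | s.1 = k})

lemma hasGenericFamily_of_generator {X Y : Set (ℕ → ℂ)} {τ : TopologicalSpace X}
    (h0X : 0 ∈ X) (h0Y : 0 ∈ Y) (h : (ℕ → ℂ) → ℕ → ℂ)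
    (hmem : ∀ (κ : GenIdx → (ℕ → Bool)) (c : GenIdx →₀ ℂ),
      (∀ s ∈ c.support,
        AgreesOnColour (Finsupp.linearCombination ℂ (generator κ h) c) (h s.2.1)) →
      c ≠ 0 → Finsupp.linearCombination ℂ (generator κ h) c ∈ X ∧
        Finsupp.linearCombination ℂ (generator κ h) c ∉ Y)
    (htend : ∀ (x : X) (σ : ℕ → ℕ → Bool) (z : ℕ → X),
      (∀ n, (z n).1 = approximant x.1 (h x.1) n (branchSet (σ n))) → Tendsto z atTop (@nhds X τ x)) :
    HasGenericFamily X Y τ := by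
  classical
  obtain ⟨κ, hκ⟩ := exists_injective_branch
  have key : ∀ c : GenIdx →₀ ℂ, c ≠ 0 → Finsupp.linearCombination ℂ (generator κ h) c ∈ X ∧
      Finsupp.linearCombination ℂ (generator κ h) c ∉ Y := fun c hc =>
    hmem κ c (fun s hs => agreesOnColour_linearCombination hκ h c hs) hc
  have hzero : ∀ c : GenIdx →₀ ℂ, Finsupp.linearCombination ℂ (generator κ h) c = 0 → c = 0 := by
    intro c hc
    by_contra hne
    exact (key c hne).2 (hc ▸ h0Y)
  have hgen : ∀ s, generator κ h s ∈ X := fun s => by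
    simpa using (key (Finsupp.single s 1) (by simp)).1
  have hall : ∀ c : GenIdx →₀ ℂ, Finsupp.linearCombination ℂ (generator κ h) c ∈ X := by
    intro c
    by_cases hc : c = 0
    · simpa [hc] using h0X
    · exact (key c hc).1
  refine ⟨ℕ → Bool, genSpan κ h, by simp, ?_, ?_, ?_, ?_⟩
  · intro k v hv
    obtain ⟨c, -, rfl⟩ := (Finsupp.mem_span_image_iff_linearCombination ℂ).1 hv
    exact hall c
  · intro k x
    let z : ℕ → X := fun n => ⟨generator κ h (k, x.1, n), hgen _⟩
    have hz := htend x (fun n => κ (k, x.1, n)) z fun n => rfl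
    refine mem_closure_of_tendsto hz (Eventually.of_forall fun n => ?_)
    exact Submodule.subset_span (Set.mem_image_of_mem _ rfl)
  · intro J v hv hsum k hk
    have h1 : ∀ j ∈ J, ∃ c ∈ Finsupp.supported ℂ ℂ {s : GenIdx | s.1 = j},
        Finsupp.linearCombination ℂ (generator κ h) c = v j := fun j hj =>
      (Finsupp.mem_span_image_iff_linearCombination ℂ).1 (hv j hj)
    choose! c hc hcv using h1
    have h2 : ∑ j ∈ J, c j = 0 := by
      apply hzero
      rw [map_sum, Finset.sum_congr rfl hcv, hsum]
    have h3 : c k = 0 := by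
      ext s
      by_cases hs : s.1 = k
      · have h4 := DFunLike.congr_fun h2 s
        rw [Finsupp.finsetSum_apply, Finset.sum_eq_single_of_mem k hk] at h4
        · exact h4
        · intro j hj hjk
          exact Finsupp.notMem_support_iff.1 fun hmem => hjk ((hc j hj hmem).symm.trans hs)
      · exact Finsupp.notMem_support_iff.1 fun hmem => hs (hc k hk hmem)
    rw [← hcv k hk, h3, map_zero]
  · intro v hv hv0
    have hle : (⨆ k, genSpan κ h k) ≤ Submodule.span ℂ (Set.range (generator κ h)) :=
      iSup_le fun k => Submodule.span_mono (Set.image_subset_range _ _)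
    obtain ⟨c, rfl⟩ := (Finsupp.mem_span_range_iff_exists_finsupp).1 (hle hv)
    rw [← Finsupp.linearCombination_apply] at hv0 ⊢
    exact key c fun hc => hv0 (by rw [hc, map_zero])

/-- A subspace of sequences closed under domination and containing the finite sequences. -/
structure IsSolid (W : Submodule ℂ (ℕ → ℂ)) : Prop where
  dominated : ∀ x ∈ W, ∀ y : ℕ → ℂ, (∀ m, ‖y m‖ ≤ ‖x m‖) → y ∈ W
  finite : ∀ x ∈ c00Set, x ∈ W

lemma IsSolid.approximant_mem {W : Submodule ℂ (ℕ → ℂ)} (hW : IsSolid W) {g : ℕ → ℂ} (hg : g ∈ W)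
    (x : ℕ → ℂ) (n : ℕ) (A : Set ℕ) : approximant x g n A ∈ W := by
  refine W.add_mem (hW.finite _ ?_) (hW.dominated _ (W.smul_mem (1 / ((n : ℂ) + 1)) hg) _ fun m => ?_)
  · exact (Set.finite_Iio n).subset Set.support_indicator_subset
  · exact norm_indicator_le_norm_self _ _

lemma hasGenericFamily_of_isSolid {X Y : Set (ℕ → ℂ)} {τ : TopologicalSpace X}
    {W : Submodule ℂ (ℕ → ℂ)} (hW : IsSolid W) (hWX : (W : Set (ℕ → ℂ)) ⊆ X) (h0Y : 0 ∈ Y)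
    {g : ℕ → ℂ} (hg : g ∈ W) (hbad : ∀ v ∈ W, AgreesOnColour v g → v ∉ Y)
    (htend : ∀ (x : X) (A : ℕ → Set ℕ) (z : ℕ → X),
      (∀ n, (z n).1 = approximant x.1 g n (A n)) → Tendsto z atTop (@nhds X τ x)) :
    HasGenericFamily X Y τ := by
  refine hasGenericFamily_of_generator (hWX W.zero_mem) h0Y (fun _ => g) ?_
    fun x σ z hz => htend x (fun n => branchSet (σ n)) z hz
  intro κ c hc hc0
  have hv : Finsupp.linearCombination ℂ (generator κ fun _ => g) c ∈ W := by
    rw [Finsupp.linearCombination_apply]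
    exact W.sum_mem fun s _ => W.smul_mem _ (hW.approximant_mem hg _ _ _)
  obtain ⟨s, hs⟩ := Finsupp.support_nonempty_iff.2 hc0
  exact ⟨hWX hv, hbad _ hv (hc s hs)⟩

/-! ### The metrics of the chain -/

lemma tendsto_topOfDist {α : Type*} {d : α → α → ℝ} (htri : ∀ x y z, d x z ≤ d x y + d y z)
    {x : α} {z : ℕ → α} (h : Tendsto (fun n => d x (z n)) atTop (𝓝 0)) :
    Tendsto z atTop (@nhds α (topOfDist d) x) := by
  refine TopologicalSpace.tendsto_nhds_generateFrom_iff.2 ?_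
  rintro _ ⟨y, r, rfl⟩ hx
  have hx' : d y x < r := hx
  filter_upwards [h.eventually_lt_const (sub_pos.2 hx')] with n hn
  have := htri y x (z n)
  change d y (z n) < r
  linarith

lemma mem_lpSet_iff_memℓp {p : ℝ} (hp : 0 < p) {x : ℕ → ℂ} :
    x ∈ lpSet p ↔ Memℓp x (ENNReal.ofReal p) := by
  have h : (ENNReal.ofReal p).toReal = p := ENNReal.toReal_ofReal hp.le
  rw [memℓp_gen_iff (by rwa [h]), h]
  rfl

lemma lpSet_mono {p q : ℝ} (hp : 0 < p) (hpq : p ≤ q) : lpSet p ⊆ lpSet q := fun _ hx =>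
  (mem_lpSet_iff_memℓp (hp.trans_le hpq)).2
    (((mem_lpSet_iff_memℓp hp).1 hx).of_exponent_ge (ENNReal.ofReal_le_ofReal hpq))

lemma mem_lpSet_of_eventually_le {p : ℝ} {x : ℕ → ℂ} {f : ℕ → ℝ} (hf : Summable f)
    (h : ∀ᶠ m in atTop, ‖x m‖ ^ p ≤ f m) : x ∈ lpSet p := by
  refine summable_of_isBigO_nat hf (Asymptotics.IsBigO.of_bound 1 ?_)
  filter_upwards [h] with m hm
  rw [one_mul, Real.norm_of_nonneg (by positivity)]
  exact hm.trans (le_abs_self _)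

/-- `ℓ^p` as a vector space. -/
def ellSubmodule (p : ℝ) (hp : 0 < p) : Submodule ℂ (ℕ → ℂ) where
  carrier := lpSet p
  add_mem' hx hy := by
    rw [mem_lpSet_iff_memℓp hp] at *
    exact hx.add hy
  zero_mem' := by
    rw [mem_lpSet_iff_memℓp hp]
    exact zero_memℓp
  smul_mem' c x hx := by
    rw [mem_lpSet_iff_memℓp hp] at *
    exact hx.const_smul c

lemma isSolid_ellSubmodule (p : ℝ) (hp : 0 < p) : IsSolid (ellSubmodule p hp) where
  dominated x hx y hxy := by
    refine Summable.of_nonneg_of_le (fun m => by positivity) (fun m => ?_) hx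
    exact Real.rpow_le_rpow (norm_nonneg _) (hxy m) hp.le
  finite x hx := by
    refine summable_of_hasFiniteSupport (Set.Finite.subset hx fun m hm => ?_)
    contrapose! hm
    simp [Function.notMem_support.1 hm, hp.ne']

/-- `⋂_{q > p} ℓ^q` as a vector space. -/
def interSubmodule (p : ℝ) (hp : 0 ≤ p) : Submodule ℂ (ℕ → ℂ) where
  carrier := interLp p
  add_mem' hx hy := Set.mem_iInter₂.2 fun q hq =>
    (ellSubmodule q (hp.trans_lt hq)).add_mem (Set.mem_iInter₂.1 hx q hq) (Set.mem_iInter₂.1 hy q hq)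
  zero_mem' := Set.mem_iInter₂.2 fun q hq => (ellSubmodule q (hp.trans_lt hq)).zero_mem
  smul_mem' c _ hx := Set.mem_iInter₂.2 fun q hq =>
    (ellSubmodule q (hp.trans_lt hq)).smul_mem c (Set.mem_iInter₂.1 hx q hq)

lemma isSolid_interSubmodule (p : ℝ) (hp : 0 ≤ p) : IsSolid (interSubmodule p hp) where
  dominated _ hx y hxy := Set.mem_iInter₂.2 fun q hq =>
    (isSolid_ellSubmodule q (hp.trans_lt hq)).dominated _ (Set.mem_iInter₂.1 hx q hq) y hxy
  finite x hx := Set.mem_iInter₂.2 fun q hq =>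
    (isSolid_ellSubmodule q (hp.trans_lt hq)).finite x hx

lemma dlp_nonneg (p : ℝ) (x y : ℕ → ℂ) : 0 ≤ dlp p x y := by
  have : 0 ≤ ∑' n, ‖x n - y n‖ ^ p := tsum_nonneg fun n => by positivity
  unfold dlp
  split_ifs
  · positivity
  · exact this

lemma dlp_triangle {p : ℝ} (hp : 0 < p) {x y z : ℕ → ℂ} (hx : x ∈ lpSet p) (hy : y ∈ lpSet p)
    (hz : z ∈ lpSet p) : dlp p x z ≤ dlp p x y + dlp p y z := by
  have hxy : Summable fun n => ‖x n - y n‖ ^ p := (ellSubmodule p hp).sub_mem hx hy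
  have hyz : Summable fun n => ‖y n - z n‖ ^ p := (ellSubmodule p hp).sub_mem hy hz
  have hxz : Summable fun n => ‖x n - z n‖ ^ p := (ellSubmodule p hp).sub_mem hx hz
  have hle : ∀ n, ‖x n - z n‖ ^ p ≤ (‖x n - y n‖ + ‖y n - z n‖) ^ p := fun n =>
    Real.rpow_le_rpow (norm_nonneg _) (norm_sub_le_norm_sub_add_norm_sub _ _ _) hp.le
  unfold dlp
  split_ifs with h1
  · obtain ⟨h2, h3⟩ := Real.Lp_add_le_tsum_of_nonneg h1 (fun n => norm_nonneg (x n - y n))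
      (fun n => norm_nonneg (y n - z n)) hxy hyz
    refine le_trans ?_ h3
    exact Real.rpow_le_rpow (tsum_nonneg fun n => by positivity) (hxz.tsum_le_tsum hle h2)
      (by positivity)
  · rw [← hxy.tsum_add hyz]
    refine hxz.tsum_le_tsum (fun n => (hle n).trans ?_) (hxy.add hyz)
    exact Real.rpow_add_le_add_rpow (norm_nonneg _) (norm_nonneg _) hp.le (not_le.1 h1).le

lemma tendsto_dlp_approximant {p : ℝ} (hp : 0 < p) {x g : ℕ → ℂ} (hx : x ∈ lpSet p)
    (hg : g ∈ lpSet p) (A : ℕ → Set ℕ) :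
    Tendsto (fun n => dlp p x (approximant x g n (A n))) atTop (𝓝 0) := by
  have hsum : Summable fun m => (‖x m‖ + ‖g m‖) ^ p := by
    have hx' : (fun m => (‖x m‖ : ℂ)) ∈ ellSubmodule p hp :=
      (isSolid_ellSubmodule p hp).dominated x hx _ fun m => by simp
    have hg' : (fun m => (‖g m‖ : ℂ)) ∈ ellSubmodule p hp :=
      (isSolid_ellSubmodule p hp).dominated g hg _ fun m => by simp
    have h : Summable _ := (ellSubmodule p hp).add_mem hx' hg'
    refine h.congr fun m => ?_
    rw [Pi.add_apply, ← Complex.ofReal_add, Complex.norm_of_nonneg (by positivity)]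
  have h1 : Tendsto (fun n => ∑' m, ‖x m - approximant x g n (A n) m‖ ^ p) atTop (𝓝 0) := by
    have := tendsto_tsum_of_dominated_convergence
      (f := fun n m => ‖x m - approximant x g n (A n) m‖ ^ p) (g := fun _ => 0) (𝓕 := atTop)
      hsum (fun m => ?_) (Eventually.of_forall fun n m => ?_)
    · simpa using this
    · simpa [hp.ne'] using (tendsto_norm_sub_approximant x g A m).rpow_const (Or.inr hp.le)
    · rw [Real.norm_of_nonneg (by positivity)]
      exact Real.rpow_le_rpow (norm_nonneg _) (norm_sub_approximant_le_add x g n (A n) m) hp.le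
  unfold dlp
  split_ifs
  · have := h1.rpow_const (p := 1 / p) (Or.inr (by positivity))
    rwa [Real.zero_rpow (one_div_ne_zero hp.ne')] at this
  · exact h1

lemma div_one_add_le_add {s t u : ℝ} (hs : 0 ≤ s) (ht : 0 ≤ t) (hu : 0 ≤ u) (h : s ≤ t + u) :
    s / (1 + s) ≤ t / (1 + t) + u / (1 + u) := by
  have h1 : s / (1 + s) ≤ (t + u) / (1 + (t + u)) := by
    rw [div_le_div_iff₀ (by positivity) (by positivity)]
    nlinarith
  have h2 : (t + u) / (1 + (t + u)) ≤ t / (1 + t) + u / (1 + u) := by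
    rw [add_div]
    gcongr <;> linarith
  exact h1.trans h2

lemma norm_dinter_term_le (p : ℝ) (x y : ℕ → ℂ) (k : ℕ) :
    ‖((1 : ℝ) / 2) ^ (k + 1) *
      (dlp (p + 1 / ((k : ℝ) + 1)) x y / (1 + dlp (p + 1 / ((k : ℝ) + 1)) x y))‖
      ≤ ((1 : ℝ) / 2) ^ (k + 1) := by
  have h := dlp_nonneg (p + 1 / ((k : ℝ) + 1)) x y
  rw [Real.norm_of_nonneg (by positivity)]
  refine mul_le_of_le_one_right (by positivity) ?_
  rw [div_le_one (by positivity)]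
  linarith

lemma summable_half_pow_succ : Summable fun k : ℕ => ((1 : ℝ) / 2) ^ (k + 1) :=
  (summable_nat_add_iff 1).2 summable_geometric_two

lemma dinter_triangle {p : ℝ} (hp : 0 ≤ p) {x y z : ℕ → ℂ} (hx : x ∈ interLp p)
    (hy : y ∈ interLp p) (hz : z ∈ interLp p) : dinter p x z ≤ dinter p x y + dinter p y z := by
  have hs : ∀ u v : ℕ → ℂ, Summable fun k : ℕ => ((1 : ℝ) / 2) ^ (k + 1) *
      (dlp (p + 1 / ((k : ℝ) + 1)) u v / (1 + dlp (p + 1 / ((k : ℝ) + 1)) u v)) := fun u v =>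
    Summable.of_norm_bounded summable_half_pow_succ (norm_dinter_term_le p u v)
  unfold dinter
  rw [← (hs x y).tsum_add (hs y z)]
  refine (hs x z).tsum_le_tsum (fun k => ?_) ((hs x y).add (hs y z))
  rw [← mul_add]
  have hk : p < p + 1 / ((k : ℝ) + 1) := lt_add_of_pos_right _ (by positivity)
  refine mul_le_mul_of_nonneg_left (div_one_add_le_add (dlp_nonneg _ _ _) (dlp_nonneg _ _ _)
    (dlp_nonneg _ _ _) (dlp_triangle (hp.trans_lt hk) ?_ ?_ ?_)) (by positivity)
  exacts [Set.mem_iInter₂.1 hx _ hk, Set.mem_iInter₂.1 hy _ hk, Set.mem_iInter₂.1 hz _ hk]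

lemma tendsto_dinter_approximant {p : ℝ} (hp : 0 ≤ p) {x g : ℕ → ℂ} (hx : x ∈ interLp p)
    (hg : g ∈ interLp p) (A : ℕ → Set ℕ) :
    Tendsto (fun n => dinter p x (approximant x g n (A n))) atTop (𝓝 0) := by
  have := tendsto_tsum_of_dominated_convergence (𝓕 := atTop)
    (f := fun (n k : ℕ) => ((1 : ℝ) / 2) ^ (k + 1) *
      (dlp (p + 1 / ((k : ℝ) + 1)) x (approximant x g n (A n)) /
        (1 + dlp (p + 1 / ((k : ℝ) + 1)) x (approximant x g n (A n)))))
    (g := fun _ => 0) summable_half_pow_succ (fun k => ?_)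
    (Eventually.of_forall fun n k => norm_dinter_term_le p _ _ k)
  · simpa [dinter] using this
  · have hk : p < p + 1 / ((k : ℝ) + 1) := lt_add_of_pos_right _ (by positivity)
    have h := tendsto_dlp_approximant (hp.trans_lt hk) (Set.mem_iInter₂.1 hx _ hk)
      (Set.mem_iInter₂.1 hg _ hk) A
    simpa using (h.div (h.const_add 1) (by norm_num)).const_mul (((1 : ℝ) / 2) ^ (k + 1))

/-- `c₀` as a vector space. -/
def c0Submodule : Submodule ℂ (ℕ → ℂ) where
  carrier := c0Set
  add_mem' hx hy := (Tendsto.add hx hy) |>.trans (le_of_eq <| by rw [add_zero])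
  zero_mem' := tendsto_const_nhds
  smul_mem' c _ hx := (Tendsto.const_smul hx c) |>.trans (le_of_eq <| by rw [smul_zero])

lemma eventually_eq_zero_of_mem_c00Set {x : ℕ → ℂ} (hx : x ∈ c00Set) :
    ∀ᶠ m in atTop, x m = 0 := by
  rw [← Nat.cofinite_eq_atTop]
  filter_upwards [Set.Finite.compl_mem_cofinite hx] with m hm
  exact Function.notMem_support.1 hm

lemma isSolid_c0Submodule : IsSolid c0Submodule where
  dominated _ hx _ hxy := squeeze_zero_norm hxy (tendsto_zero_iff_norm_tendsto_zero.1 hx)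
  finite _ hx := tendsto_const_nhds.congr'
    ((eventually_eq_zero_of_mem_c00Set hx).mono fun _ hm => hm.symm)

lemma c0Set_subset_linfSet : c0Set ⊆ linfSet := by
  intro x hx
  obtain ⟨C, hC⟩ := (Metric.isBounded_range_of_tendsto x hx).exists_norm_le
  exact ⟨C, fun n => hC _ (Set.mem_range_self n)⟩

lemma bddAbove_norm_sub {x y : ℕ → ℂ} (hx : x ∈ c0Set) (hy : y ∈ c0Set) :
    BddAbove (Set.range fun n => ‖x n - y n‖) := by
  obtain ⟨C, hC⟩ := c0Set_subset_linfSet (c0Submodule.sub_mem hx hy)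
  exact ⟨C, Set.forall_mem_range.2 hC⟩

lemma dsup_triangle {x y z : ℕ → ℂ} (hx : x ∈ c0Set) (hy : y ∈ c0Set) (hz : z ∈ c0Set) :
    dsup x z ≤ dsup x y + dsup y z :=
  ciSup_le fun n => (norm_sub_le_norm_sub_add_norm_sub _ (y n) _).trans
    (add_le_add (le_ciSup (bddAbove_norm_sub hx hy) n) (le_ciSup (bddAbove_norm_sub hy hz) n))

lemma tendsto_dsup_approximant {x g : ℕ → ℂ} (hx : x ∈ c0Set) (hg : g ∈ c0Set) (A : ℕ → Set ℕ) :
    Tendsto (fun n => dsup x (approximant x g n (A n))) atTop (𝓝 0) := by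
  obtain ⟨C, hC⟩ := c0Set_subset_linfSet hg
  have hC' : Tendsto (fun n : ℕ => 1 / ((n : ℝ) + 1) * C) atTop (𝓝 0) := by
    simpa using tendsto_one_div_add_atTop_nhds_zero_nat.mul_const C
  rw [Metric.tendsto_atTop']
  intro ε hε
  obtain ⟨N, hN⟩ := eventually_atTop.1 ((tendsto_zero_iff_norm_tendsto_zero.1 hx).eventually_lt_const
    (show 0 < ε / 3 by positivity))
  obtain ⟨M, hM⟩ := eventually_atTop.1 (hC'.eventually_lt_const (show 0 < ε / 3 by positivity))
  refine ⟨max N M, fun n hn => ?_⟩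
  have hle : dsup x (approximant x g n (A n)) ≤ ε / 3 + ε / 3 := by
    refine ciSup_le fun m => (norm_sub_approximant_le x g n (A n) m).trans (add_le_add ?_ ?_)
    · refine Set.indicator_apply_le' (fun hm => ?_) fun _ => by positivity
      exact (hN m (((le_max_left _ _).trans hn.le).trans hm)).le
    · refine le_trans ?_ (hM n ((le_max_right _ _).trans hn.le)).le
      exact mul_le_mul_of_nonneg_left (hC m) (by positivity)
  have h0 : 0 ≤ dsup x (approximant x g n (A n)) := Real.iSup_nonneg fun m => norm_nonneg _
  rw [Real.dist_eq, sub_zero, abs_of_nonneg h0]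
  linarith

/-! ### The space `H(𝔻)` -/

/-- The sequences `x` for which `∑ x n z ^ n` converges absolutely on the unit disk. -/
def holoSubmodule : Submodule ℂ (ℕ → ℂ) where
  carrier := {x | ∀ ρ : ℝ, 0 < ρ → ρ < 1 → Summable fun n => ‖x n‖ * ρ ^ n}
  add_mem' {x y} hx hy ρ h0 h1 := by
    refine Summable.of_nonneg_of_le (fun n => by positivity) (fun n => ?_)
      ((hx ρ h0 h1).add (hy ρ h0 h1))
    rw [← add_mul]
    exact mul_le_mul_of_nonneg_right (norm_add_le _ _) (by positivity)
  zero_mem' ρ _ _ := by simp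
  smul_mem' c x hx ρ h0 h1 := by
    simpa [mul_assoc] using (hx ρ h0 h1).mul_left ‖c‖

lemma isSolid_holoSubmodule : IsSolid holoSubmodule where
  dominated x hx y hxy ρ h0 h1 := by
    refine Summable.of_nonneg_of_le (fun n => by positivity) (fun n => ?_) (hx ρ h0 h1)
    exact mul_le_mul_of_nonneg_right (hxy n) (by positivity)
  finite x hx ρ h0 h1 := by
    refine summable_of_hasFiniteSupport (Set.Finite.subset hx fun m hm => ?_)
    contrapose! hm
    simp [Function.notMem_support.1 hm]

lemma linfSet_subset_holoSubmodule : linfSet ⊆ holoSubmodule := by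
  rintro x ⟨C, hC⟩ ρ h0 h1
  refine Summable.of_nonneg_of_le (fun n => by positivity) (fun n => ?_)
    ((summable_geometric_of_lt_one h0.le h1).mul_left C)
  exact mul_le_mul_of_nonneg_right (hC n) (by positivity)

lemma natCast_mem_holoSubmodule : (fun m : ℕ => (m : ℂ)) ∈ holoSubmodule := by
  intro ρ h0 h1
  simpa using summable_pow_mul_geometric_of_norm_lt_one 1
    (r := ρ) (by rwa [Real.norm_of_nonneg h0.le])

/-- The sequences whose power series has radius of convergence zero. -/
def HasZeroRadius (x : ℕ → ℂ) : Prop := ∀ C : ℝ, 0 < C → ∃ᶠ n in atTop, C ^ n < ‖x n‖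

lemma norm_rpow_one_div_le_iff {x : ℕ → ℂ} {C : ℝ} (hC : 0 ≤ C) {n : ℕ} (hn : 0 < n) :
    ‖x n‖ ^ (1 / (n : ℝ)) ≤ C ↔ ‖x n‖ ≤ C ^ n := by
  rw [one_div, Real.rpow_inv_le_iff_of_pos (norm_nonneg _) hC (by exact_mod_cast hn),
    Real.rpow_natCast]

lemma eventually_norm_le_pow {x : ℕ → ℂ} (hx : x ∈ holoSubmodule) {r : ℝ} (hr : 1 < r) :
    ∀ᶠ n in atTop, ‖x n‖ ≤ r ^ n := by
  have hr0 : 0 < r := one_pos.trans hr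
  have h := (hx r⁻¹ (by positivity) (inv_lt_one_of_one_lt₀ hr)).tendsto_atTop_zero
  filter_upwards [h.eventually_le_const one_pos] with n hn
  rwa [inv_pow, ← div_eq_mul_inv, div_le_one (by positivity)] at hn

lemma not_hasZeroRadius {x : ℕ → ℂ} (hx : x ∈ holoSubmodule) : ¬ HasZeroRadius x := by
  intro h
  obtain ⟨n, h1, h2⟩ :=
    ((h 2 two_pos).and_eventually (eventually_norm_le_pow hx one_lt_two)).exists
  exact h1.not_ge h2

lemma holoSubmodule_subset_HdSet : (holoSubmodule : Set (ℕ → ℂ)) ⊆ HdSet := by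
  intro x hx
  change limsup _ _ ≤ (1 : ℝ)
  refine le_of_forall_pos_le_add fun ε hε => ?_
  refine limsup_le_of_le (isCoboundedUnder_le_of_le atTop (x := 0) fun n => by positivity) ?_
  filter_upwards [eventually_norm_le_pow hx (lt_add_of_pos_right 1 hε), eventually_gt_atTop 0]
    with n hn hn0
  exact (norm_rpow_one_div_le_iff (by positivity) hn0).2 hn

lemma HasZeroRadius.mem_HdSet {x : ℕ → ℂ} (hx : HasZeroRadius x) : x ∈ HdSet := by
  have : {a : ℝ | ∀ᶠ n : ℕ in atTop, ‖x n‖ ^ (1 / (n : ℝ)) ≤ a} = ∅ := by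
    refine Set.eq_empty_of_forall_notMem fun a ha => ?_
    obtain ⟨n, h1, h2, h3⟩ := ((hx (max a 1) (by positivity)).and_eventually
      ((show ∀ᶠ n : ℕ in atTop, ‖x n‖ ^ (1 / (n : ℝ)) ≤ a from ha).and
        (eventually_gt_atTop 0))).exists
    exact h1.not_ge ((norm_rpow_one_div_le_iff (by positivity) h3).1 (h2.trans (le_max_left _ _)))
  change limsup _ _ ≤ (1 : ℝ)
  rw [limsup_eq, this, Real.sInf_empty]
  exact zero_le_one

lemma mem_holoSubmodule_or_hasZeroRadius {x : ℕ → ℂ} (hx : x ∈ HdSet) :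
    x ∈ holoSubmodule ∨ HasZeroRadius x := by
  by_cases hb : IsBoundedUnder (· ≤ ·) atTop fun n : ℕ => ‖x n‖ ^ (1 / (n : ℝ))
  · refine Or.inl fun ρ h0 h1 => ?_
    obtain ⟨r, hr1, hr2⟩ := exists_between ((one_lt_inv₀ h0).2 h1)
    have hr0 : 0 < r := one_pos.trans hr1
    have hrρ : r * ρ < 1 := by rwa [← lt_div_iff₀ h0, one_div]
    refine summable_of_isBigO_nat (summable_geometric_of_lt_one (by positivity) hrρ)
      (Asymptotics.IsBigO.of_bound 1 ?_)
    have hx' : limsup (fun n : ℕ => ‖x n‖ ^ (1 / (n : ℝ))) atTop < r := lt_of_le_of_lt hx hr1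
    filter_upwards [eventually_lt_of_limsup_lt hx' hb, eventually_gt_atTop 0] with n hn hn0
    rw [Real.norm_of_nonneg (by positivity), Real.norm_of_nonneg (by positivity), one_mul, mul_pow]
    exact mul_le_mul_of_nonneg_right ((norm_rpow_one_div_le_iff hr0.le hn0).1 hn.le)
      (by positivity)
  · refine Or.inr fun C hC => ?_
    by_contra hne
    refine hb ⟨C, ?_⟩
    rw [eventually_map]
    filter_upwards [not_frequently.1 hne, eventually_gt_atTop 0] with n hn hn0
    exact (norm_rpow_one_div_le_iff hC.le hn0).2 (not_lt.1 hn)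

lemma HasZeroRadius.not_summable {x : ℕ → ℂ} (hx : HasZeroRadius x) {z : ℂ} (hz : z ≠ 0) :
    ¬ Summable fun n => x n * z ^ n := by
  intro h
  have hz' : 0 < ‖z‖ := norm_pos_iff.2 hz
  have h1 := (tendsto_zero_iff_norm_tendsto_zero.1 h.tendsto_atTop_zero).eventually_le_const one_pos
  obtain ⟨n, h2, h3⟩ := ((hx ‖z‖⁻¹ (by positivity)).and_eventually h1).exists
  rw [norm_mul, norm_pow] at h3
  rw [inv_pow, inv_lt_iff_one_lt_mul₀ (by positivity)] at h2
  linarith [mul_comm (‖z‖ ^ n) ‖x n‖]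

lemma taylorSum_eq_of_hasZeroRadius {x y : ℕ → ℂ} (hx : HasZeroRadius x) (hy : HasZeroRadius y)
    (h : x 0 = y 0) : taylorSum x = taylorSum y := by
  funext z
  unfold taylorSum
  by_cases hz : (z : ℂ) = 0
  · rw [tsum_eq_single 0 fun n hn => by simp [hz, hn], tsum_eq_single 0 fun n hn => by simp [hz, hn],
      h]
  · rw [tsum_eq_zero_of_not_summable (hx.not_summable hz),
      tsum_eq_zero_of_not_summable (hy.not_summable hz)]

lemma hasZeroRadius_of_agreesOnColour {v : ℕ → ℂ}
    (hv : AgreesOnColour v fun m => (m : ℂ) * (m.factorial : ℂ)) : HasZeroRadius v := by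
  obtain ⟨t, c, hc, h⟩ := hv
  intro C hC
  have hlim := (FloorSemiring.tendsto_pow_div_factorial_atTop C).eventually_lt_const
    (norm_pos_iff.2 hc)
  refine ((frequently_dyadicColour t).and_eventually
    (h.and (hlim.and (eventually_gt_atTop 0)))).mono ?_
  rintro m ⟨h1, h2, h3, h4⟩
  have hm : (1 : ℝ) ≤ m := by exact_mod_cast h4
  rw [h2 h1, norm_mul, norm_mul, Complex.norm_natCast, Complex.norm_natCast]
  rw [div_lt_iff₀ (by positivity)] at h3
  refine h3.trans_le (mul_le_mul_of_nonneg_left ?_ (norm_nonneg _))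
  exact le_mul_of_one_le_left (by positivity) hm

lemma agreesOnColour_approximant (x g : ℕ → ℂ) (n : ℕ) (σ : ℕ → Bool) :
    AgreesOnColour (approximant x g n (branchSet σ)) g := by
  refine ⟨prefixCode σ 0, 1 / ((n : ℂ) + 1), one_div_ne_zero (Nat.cast_add_one_ne_zero _), ?_⟩
  filter_upwards [eventually_ge_atTop n] with m hm hmt
  have hA : m ∈ branchSet σ := ⟨0, hmt.symm⟩
  simp [approximant, hm, hA]

lemma exists_norm_le_of_isCompact {K : Set unitBall} (hK : IsCompact K) :
    ∃ ρ : ℝ, 0 < ρ ∧ ρ < 1 ∧ ∀ z ∈ K, ‖(z : ℂ)‖ ≤ ρ := by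
  rcases K.eq_empty_or_nonempty with rfl | hne
  · exact ⟨1 / 2, by norm_num, by norm_num, by simp⟩
  · obtain ⟨w, -, hw⟩ := hK.exists_isMaxOn hne
      (continuous_norm.comp continuous_subtype_val).continuousOn
    have hw1 : ‖(w : ℂ)‖ < 1 := mem_ball_zero_iff.1 w.2
    refine ⟨max ‖(w : ℂ)‖ (1 / 2), by positivity, max_lt hw1 (by norm_num), fun z hz => ?_⟩
    exact (hw hz).trans (le_max_left _ _)

lemma norm_taylorSum_sub_le {x y : ℕ → ℂ} (hx : x ∈ holoSubmodule) (hy : y ∈ holoSubmodule)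
    {ρ : ℝ} (h0 : 0 < ρ) (h1 : ρ < 1) {z : unitBall} (hz : ‖(z : ℂ)‖ ≤ ρ) :
    ‖taylorSum x z - taylorSum y z‖ ≤ ∑' m, ‖x m - y m‖ * ρ ^ m := by
  have hle : ∀ (u : ℕ → ℂ) m, ‖u m * (z : ℂ) ^ m‖ ≤ ‖u m‖ * ρ ^ m := fun u m => by
    rw [norm_mul, norm_pow]
    gcongr
  have hsum : ∀ u ∈ holoSubmodule, Summable fun m => ‖u m * (z : ℂ) ^ m‖ := fun u hu =>
    Summable.of_nonneg_of_le (fun m => norm_nonneg _) (hle u) (hu ρ h0 h1)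
  have hxy := holoSubmodule.sub_mem hx hy
  unfold taylorSum
  rw [← (hsum x hx).of_norm.tsum_sub (hsum y hy).of_norm]
  simp_rw [← sub_mul]
  exact (norm_tsum_le_tsum_norm (hsum _ hxy)).trans
    ((hsum _ hxy).tsum_le_tsum (hle (x - y)) (hxy ρ h0 h1))

lemma tendsto_HdTopology_approximant {x : HdSet} (hx : x.1 ∈ holoSubmodule) {g : ℕ → ℂ}
    (hg : g ∈ holoSubmodule) (A : ℕ → Set ℕ) {z : ℕ → HdSet}
    (hz : ∀ n, (z n).1 = approximant x.1 g n (A n)) :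
    Tendsto z atTop (@nhds HdSet HdTopology x) := by
  rw [HdTopology, nhds_induced, tendsto_comap_iff, UniformOnFun.tendsto_iff_tendstoUniformlyOn]
  intro K hK
  obtain ⟨ρ, h0, h1, hρ⟩ := exists_norm_le_of_isCompact hK
  have hlim : Tendsto (fun n => ∑' m, ‖x.1 m - approximant x.1 g n (A n) m‖ * ρ ^ m) atTop
      (𝓝 0) := by
    have := tendsto_tsum_of_dominated_convergence (𝓕 := atTop)
      (f := fun (n : ℕ) (m : ℕ) => ‖x.1 m - approximant x.1 g n (A n) m‖ * ρ ^ m)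
      (g := fun _ => 0) ((hx ρ h0 h1).add (hg ρ h0 h1)) (fun m => ?_)
      (Eventually.of_forall fun n m => ?_)
    · simpa using this
    · simpa using (tendsto_norm_sub_approximant x.1 g A m).mul_const (ρ ^ m)
    · rw [Real.norm_of_nonneg (by positivity), ← add_mul]
      exact mul_le_mul_of_nonneg_right (norm_sub_approximant_le_add x.1 g n (A n) m)
        (by positivity)
  rw [Metric.tendstoUniformlyOn_iff]
  intro ε hε
  filter_upwards [hlim.eventually_lt_const hε] with n hn w hw
  rw [dist_eq_norm]
  refine lt_of_le_of_lt (norm_taylorSum_sub_le hx ?_ h0 h1 (hρ w hw)) (by rwa [hz n])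
  rw [hz n]
  exact isSolid_holoSubmodule.approximant_mem hg _ _ _

lemma tendsto_HdTopology_of_taylorSum_eq {x : HdSet} {z : ℕ → HdSet}
    (hz : ∀ᶠ n in atTop, taylorSum (z n).1 = taylorSum x.1) :
    Tendsto z atTop (@nhds HdSet HdTopology x) := by
  rw [HdTopology, nhds_induced, tendsto_comap_iff]
  refine tendsto_const_nhds.congr' (hz.mono fun n hn => ?_)
  rw [Function.comp_apply, hn]

open Classical in
lemma hasGenericFamily_HdSet : HasGenericFamily HdSet linfSet HdTopology := by
  refine hasGenericFamily_of_generator (holoSubmodule_subset_HdSet holoSubmodule.zero_mem)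
    (c0Set_subset_linfSet c0Submodule.zero_mem)
    (fun x => if x ∈ holoSubmodule then fun m => (m : ℂ) else fun m => (m : ℂ) * (m.factorial : ℂ))
    ?_ ?_
  · intro κ c hc hc0
    by_cases hs : ∃ s ∈ c.support, s.2.1 ∉ holoSubmodule
    · obtain ⟨s, hs, hsx⟩ := hs
      have h := hc s hs
      rw [if_neg hsx] at h
      have hzero := hasZeroRadius_of_agreesOnColour h
      exact ⟨hzero.mem_HdSet, fun hb => not_hasZeroRadius (linfSet_subset_holoSubmodule hb) hzero⟩
    · push Not at hs
      refine ⟨holoSubmodule_subset_HdSet ?_, ?_⟩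
      · rw [Finsupp.linearCombination_apply]
        refine holoSubmodule.sum_mem fun s hsc => holoSubmodule.smul_mem _
          (isSolid_holoSubmodule.approximant_mem ?_ _ _ _)
        beta_reduce
        rw [if_pos (hs s hsc)]
        exact natCast_mem_holoSubmodule
      · rintro ⟨C, hC⟩
        obtain ⟨s, hsc⟩ := Finsupp.support_nonempty_iff.2 hc0
        have h := hc s hsc
        rw [if_pos (hs s hsc)] at h
        obtain ⟨t, d, hd, h⟩ := h
        have hlim : Tendsto (fun m : ℕ => ‖d‖ * m) atTop atTop :=
          tendsto_natCast_atTop_atTop.const_mul_atTop (norm_pos_iff.2 hd)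
        obtain ⟨m, h1, h2, h3⟩ := ((frequently_dyadicColour t).and_eventually
          (h.and (hlim.eventually_gt_atTop C))).exists
        have h4 := hC m
        rw [h2 h1, norm_mul, Complex.norm_natCast] at h4
        exact h3.not_ge h4
  · intro x σ z hz
    by_cases hx : x.1 ∈ holoSubmodule
    · rw [if_pos hx] at hz
      exact tendsto_HdTopology_approximant hx natCast_mem_holoSubmodule _ hz
    · rw [if_neg hx] at hz
      refine tendsto_HdTopology_of_taylorSum_eq ?_
      filter_upwards [eventually_gt_atTop 0] with n hn
      refine taylorSum_eq_of_hasZeroRadius ?_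
        ((mem_holoSubmodule_or_hasZeroRadius x.2).resolve_left hx) ?_
      · rw [hz n]
        exact hasZeroRadius_of_agreesOnColour (agreesOnColour_approximant _ _ _ _)
      · rw [hz n]
        simp [approximant, hn, Set.indicator_apply]

/-- The sequences dominated by a multiple of `2 ^ m`. -/
def geomSubmodule : Submodule ℂ (ℕ → ℂ) where
  carrier := {x | ∃ C : ℝ, ∀ m, ‖x m‖ ≤ C * 2 ^ m}
  add_mem' := by
    rintro x y ⟨C, hC⟩ ⟨D, hD⟩
    refine ⟨C + D, fun m => (norm_add_le _ _).trans ?_⟩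
    rw [add_mul]
    exact add_le_add (hC m) (hD m)
  zero_mem' := ⟨0, by simp⟩
  smul_mem' := by
    rintro c x ⟨C, hC⟩
    refine ⟨‖c‖ * C, fun m => ?_⟩
    rw [Pi.smul_apply, norm_smul, mul_assoc]
    exact mul_le_mul_of_nonneg_left (hC m) (norm_nonneg _)

lemma isSolid_geomSubmodule : IsSolid geomSubmodule where
  dominated := fun _ ⟨C, hC⟩ _ hxy => ⟨C, fun m => (hxy m).trans (hC m)⟩
  finite x hx := by
    obtain ⟨C, hC⟩ := c0Set_subset_linfSet (isSolid_c0Submodule.finite x hx)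
    refine ⟨C, fun m => (hC m).trans ?_⟩
    exact le_mul_of_one_le_right ((norm_nonneg _).trans (hC 0)) (one_le_pow₀ one_le_two)

lemma notMem_HdSet_of_agreesOnColour {v : ℕ → ℂ} (hv : v ∈ geomSubmodule)
    (h : AgreesOnColour v fun m => (2 : ℂ) ^ m) : v ∉ HdSet := by
  intro hHd
  rcases mem_holoSubmodule_or_hasZeroRadius hHd with hh | hh
  · obtain ⟨t, c, hc, h⟩ := h
    have hlim := (hh (1 / 2) (by norm_num) (by norm_num)).tendsto_atTop_zero
    obtain ⟨m, h1, h2, h3⟩ := ((frequently_dyadicColour t).and_eventually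
      (h.and (hlim.eventually_lt_const (norm_pos_iff.2 hc)))).exists
    rw [h2 h1, norm_mul, norm_pow, mul_assoc, Complex.norm_ofNat, ← mul_pow] at h3
    norm_num at h3
  · obtain ⟨C, hC⟩ := hv
    obtain ⟨m, h1, h2⟩ := ((hh (max C 1 * 2) (by positivity)).and_eventually
      (eventually_gt_atTop 0)).exists
    refine h1.not_ge ((hC m).trans ?_)
    rw [mul_pow]
    refine mul_le_mul_of_nonneg_right ((le_max_left C 1).trans ?_) (by positivity)
    exact le_self_pow₀ (le_max_right C 1) h2.ne'

lemma tendsto_subtype_approximant {X : Set (ℕ → ℂ)} {g : ℕ → ℂ} (x : X) (A : ℕ → Set ℕ) (z : ℕ → X)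
    (hz : ∀ n, (z n).1 = approximant x.1 g n (A n)) : Tendsto z atTop (𝓝 x) := by
  refine tendsto_subtype_rng.2 (tendsto_pi_nhds.2 fun m => ?_)
  simp_rw [hz]
  rw [tendsto_iff_norm_sub_tendsto_zero]
  simpa [norm_sub_rev] using tendsto_norm_sub_approximant x.1 g A m

lemma hasGenericFamily_univ :
    HasGenericFamily Set.univ HdSet instTopologicalSpaceSubtype :=
  hasGenericFamily_of_isSolid isSolid_geomSubmodule (Set.subset_univ _)
    (holoSubmodule_subset_HdSet holoSubmodule.zero_mem) (g := fun m => (2 : ℂ) ^ m)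
    ⟨1, fun m => by simp⟩ (fun _ => notMem_HdSet_of_agreesOnColour) tendsto_subtype_approximant

/-! ### The spaces of null sequences -/

/-- The sequence `m ^ (-c)`. -/
def powerSeq (c : ℝ) (m : ℕ) : ℂ := (((m : ℝ) ^ (-c) : ℝ) : ℂ)

lemma norm_powerSeq (c : ℝ) (m : ℕ) : ‖powerSeq c m‖ = (m : ℝ) ^ (-c) :=
  Complex.norm_of_nonneg (by positivity)

lemma norm_powerSeq_rpow (c q : ℝ) (m : ℕ) : ‖powerSeq c m‖ ^ q = (m : ℝ) ^ (-(c * q)) := by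
  rw [norm_powerSeq, ← Real.rpow_mul (Nat.cast_nonneg m), neg_mul]

lemma powerSeq_mem_lpSet {c q : ℝ} (h : 1 < c * q) : powerSeq c ∈ lpSet q := by
  have : Summable fun m : ℕ => (m : ℝ) ^ (-(c * q)) := Real.summable_nat_rpow.2 (neg_lt_neg h)
  exact this.congr fun m => (norm_powerSeq_rpow c q m).symm

lemma notMem_lpSet_of_agreesOnColour {c q : ℝ} (h : c * q = 1) {v : ℕ → ℂ}
    (hv : AgreesOnColour v (powerSeq c)) : v ∉ lpSet q := by
  obtain ⟨t, d, hd, hv⟩ := hv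
  have hd' : 0 < ‖d‖ := norm_pos_iff.2 hd
  refine not_summable_of_div_le (C := ‖d‖ ^ q) (t := t) (by positivity) (hv.mono fun m hm hmt => ?_)
  rw [hm hmt, norm_mul, Real.mul_rpow (norm_nonneg _) (norm_nonneg _), norm_powerSeq_rpow, h,
    Real.rpow_neg_one, div_eq_mul_inv]

lemma hasGenericFamily_topOfDist (d : (ℕ → ℂ) → (ℕ → ℂ) → ℝ) {X Y : Set (ℕ → ℂ)}
    {W : Submodule ℂ (ℕ → ℂ)} (hW : IsSolid W) (hWX : (W : Set (ℕ → ℂ)) = X) (h0 : 0 ∈ Y)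
    {g : ℕ → ℂ} (hg : g ∈ X) (hbad : ∀ v, AgreesOnColour v g → v ∉ Y)
    (htri : ∀ x ∈ X, ∀ y ∈ X, ∀ z ∈ X, d x z ≤ d x y + d y z)
    (htend : ∀ x ∈ X, ∀ A : ℕ → Set ℕ,
      Tendsto (fun n => d x (approximant x g n (A n))) atTop (𝓝 0)) :
    HasGenericFamily X Y (topOfDist fun x y : X => d x.1 y.1) := by
  refine hasGenericFamily_of_isSolid hW hWX.subset h0 (hWX.symm.subset hg) (fun v _ => hbad v) ?_
  intro x A z hz
  have htri' : ∀ x y z : X, d x.1 z.1 ≤ d x.1 y.1 + d y.1 z.1 := fun x y z =>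
    htri x.1 x.2 y.1 y.2 z.1 z.2
  refine tendsto_topOfDist (d := fun x y : X => d x.1 y.1) htri' ?_
  simp_rw [hz]
  exact htend x.1 x.2 A

lemma hasGenericFamily_c0Set {p : ℝ} (hp : 0 < p) :
    HasGenericFamily c0Set (interLp p) (topOfDist fun x y => dsup x.1 y.1) := by
  have hg : powerSeq (1 / (p + 1)) ∈ c0Set := by
    refine tendsto_zero_iff_norm_tendsto_zero.2 ?_
    simp_rw [norm_powerSeq]
    exact (tendsto_rpow_neg_atTop (by positivity)).comp tendsto_natCast_atTop_atTop
  refine hasGenericFamily_topOfDist dsup isSolid_c0Submodule rfl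
    (interSubmodule p hp.le).zero_mem hg (fun v hv hmem => ?_)
    (fun _ hx _ hy _ hz => dsup_triangle hx hy hz) fun _ hx => tendsto_dsup_approximant hx hg
  exact notMem_lpSet_of_agreesOnColour (by field_simp) hv
    (Set.mem_iInter₂.1 hmem (p + 1) (lt_add_one p))

lemma hasGenericFamily_interLp {p : ℝ} (hp : 0 ≤ p) {Y : Set (ℕ → ℂ)} (h0 : 0 ∈ Y) {g : ℕ → ℂ}
    (hg : g ∈ interLp p) (hbad : ∀ v, AgreesOnColour v g → v ∉ Y) :
    HasGenericFamily (interLp p) Y (topOfDist fun x y => dinter p x.1 y.1) :=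
  hasGenericFamily_topOfDist (dinter p) (isSolid_interSubmodule p hp) rfl h0 hg hbad
    (fun _ hx _ hy _ hz => dinter_triangle hp hx hy hz)
    fun _ hx => tendsto_dinter_approximant hp hx hg

lemma hasGenericFamily_interLp_lpSet {p : ℝ} (hp : 0 < p) :
    HasGenericFamily (interLp p) (lpSet p) (topOfDist fun x y => dinter p x.1 y.1) := by
  refine hasGenericFamily_interLp hp.le (ellSubmodule p hp).zero_mem (g := powerSeq (1 / p)) ?_
    fun v => notMem_lpSet_of_agreesOnColour (by field_simp)
  refine Set.mem_iInter₂.2 fun q hq => powerSeq_mem_lpSet ?_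
  rw [one_div_mul_eq_div, one_lt_div hp]
  exact hq

lemma hasGenericFamily_lpSet_interLp {p q : ℝ} (hp : 0 ≤ p) (hpq : p < q) :
    HasGenericFamily (lpSet q) (interLp p) (topOfDist fun x y => dlp q x.1 y.1) := by
  have hq : 0 < q := hp.trans_lt hpq
  have hg : powerSeq (2 / (p + q)) ∈ lpSet q := by
    refine powerSeq_mem_lpSet ?_
    rw [div_mul_eq_mul_div, one_lt_div (by positivity)]
    linarith
  refine hasGenericFamily_topOfDist (dlp q) (isSolid_ellSubmodule q hq) rfl
    (interSubmodule p hp).zero_mem hg (fun v hv hmem => ?_)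
    (fun _ hx _ hy _ hz => dlp_triangle hq hx hy hz) fun _ hx => tendsto_dlp_approximant hq hx hg
  refine notMem_lpSet_of_agreesOnColour (q := (p + q) / 2) ?_ hv
    (Set.mem_iInter₂.1 hmem _ (show p < (p + q) / 2 by linarith))
  have : p + q ≠ 0 := by positivity
  field_simp

/-- The sequence equal to `1 / m` at the powers of two and to `0` elsewhere. -/
def lacunarySeq : ℕ → ℂ := (Set.range fun k : ℕ => 2 ^ k).indicator fun m => (m : ℂ)⁻¹

lemma lacunarySeq_two_pow (k : ℕ) : lacunarySeq (2 ^ k) = ((2 : ℂ) ^ k)⁻¹ := by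
  rw [lacunarySeq, Set.indicator_of_mem (Set.mem_range_self k)]
  push_cast
  rfl

lemma lacunarySeq_mem_interLp_zero : lacunarySeq ∈ interLp 0 := by
  refine Set.mem_iInter₂.2 fun q hq => ?_
  have hq : 0 < q := hq
  refine ((Nat.pow_right_injective le_rfl).summable_iff fun m hm => ?_).1 (?_ : Summable
    ((fun m => ‖lacunarySeq m‖ ^ q) ∘ fun k : ℕ => 2 ^ k))
  · rw [lacunarySeq, Set.indicator_of_notMem hm, norm_zero, Real.zero_rpow hq.ne']
  · have h : Summable fun k : ℕ => ((2⁻¹ : ℝ) ^ q) ^ k :=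
      summable_geometric_of_lt_one (by positivity)
        (Real.rpow_lt_one (by norm_num) (by norm_num) hq)
    refine h.congr fun k => ?_
    rw [Function.comp_apply, lacunarySeq_two_pow, norm_inv, norm_pow, Complex.norm_ofNat,
      ← inv_pow, ← Real.rpow_natCast, ← Real.rpow_mul (by norm_num), mul_comm,
      Real.rpow_mul (by norm_num), Real.rpow_natCast]

/-- `A^∞(𝔻)` as a vector space. -/
def AinfSubmodule : Submodule ℂ (ℕ → ℂ) where
  carrier := AinfSet
  add_mem' hx hy k := by simpa [mul_add] using (hx k).add (hy k)
  zero_mem' k := by simp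
  smul_mem' c x hx k := by simpa [mul_left_comm] using (hx k).const_mul c

lemma isSolid_AinfSubmodule : IsSolid AinfSubmodule where
  dominated x hx y hxy k := by
    refine squeeze_zero_norm (fun m => ?_) (tendsto_zero_iff_norm_tendsto_zero.1 (hx k))
    rw [norm_mul, norm_mul]
    exact mul_le_mul_of_nonneg_left (hxy m) (norm_nonneg _)
  finite x hx k := tendsto_const_nhds.congr'
    ((eventually_eq_zero_of_mem_c00Set hx).mono fun m hm => by simp [hm])

lemma hasGenericFamily_interLp_zero :
    HasGenericFamily (interLp 0) AinfSet (topOfDist fun x y => dinter 0 x.1 y.1) := by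
  refine hasGenericFamily_interLp le_rfl AinfSubmodule.zero_mem lacunarySeq_mem_interLp_zero ?_
  rintro v ⟨t, c, hc, h⟩ hv
  have htwo : Tendsto (fun k : ℕ => 2 ^ k) atTop atTop :=
    tendsto_pow_atTop_atTop_of_one_lt (one_lt_two : (1 : ℕ) < 2)
  have hlim := (tendsto_zero_iff_norm_tendsto_zero.1 ((hv 1).comp htwo)).eventually_lt_const
    (norm_pos_iff.2 hc)
  obtain ⟨k, h1, h2, h3⟩ := ((frequently_two_pow_dyadicColour t).and_eventually
    ((htwo.eventually h).and hlim)).exists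
  have h4 : (2 : ℂ) ^ k ≠ 0 := pow_ne_zero k two_ne_zero
  rw [Function.comp_apply, h2 h1, lacunarySeq_two_pow, pow_one, Nat.cast_pow, Nat.cast_ofNat,
    mul_left_comm, mul_inv_cancel₀ h4, mul_one] at h3
  exact lt_irrefl _ h3

lemma hasGenericFamily_AinfSet :
    HasGenericFamily AinfSet c00Set instTopologicalSpaceSubtype := by
  have hg : (fun m => (2⁻¹ : ℂ) ^ m) ∈ AinfSet := fun k => by
    have h2 : ‖(2⁻¹ : ℂ)‖ < 1 := by norm_num
    exact (summable_pow_mul_geometric_of_norm_lt_one k h2).tendsto_atTop_zero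
  refine hasGenericFamily_of_isSolid isSolid_AinfSubmodule subset_rfl (by simp [c00Set]) hg ?_
    tendsto_subtype_approximant
  rintro v - ⟨t, c, hc, h⟩ hv
  obtain ⟨m, h1, h2, h3⟩ := ((frequently_dyadicColour t).and_eventually
    (h.and (eventually_eq_zero_of_mem_c00Set hv))).exists
  rw [h2 h1] at h3
  exact mul_ne_zero hc (pow_ne_zero m (inv_ne_zero two_ne_zero)) h3

/-! ### The chain -/

lemma AinfSet_subset_interLp_zero : AinfSet ⊆ interLp 0 := by
  intro x hx
  refine Set.mem_iInter₂.2 fun q hq => ?_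
  have hq : 0 < q := hq
  obtain ⟨k, hk⟩ := exists_nat_gt (1 / q)
  rw [div_lt_iff₀ hq] at hk
  refine mem_lpSet_of_eventually_le (Real.summable_nat_rpow.2 (neg_lt_neg hk)) ?_
  have hlim := (tendsto_zero_iff_norm_tendsto_zero.1 (hx k)).eventually_le_const one_pos
  filter_upwards [hlim, eventually_gt_atTop 0] with m hm hm0
  have hm0 : (0 : ℝ) < m := by exact_mod_cast hm0
  rw [norm_mul, norm_pow, Complex.norm_natCast, mul_comm, ← le_div_iff₀ (by positivity)] at hm
  refine (Real.rpow_le_rpow (norm_nonneg _) hm hq.le).trans (le_of_eq ?_)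
  rw [one_div, ← Real.rpow_natCast, ← Real.rpow_neg hm0.le, ← Real.rpow_mul hm0.le, neg_mul]

lemma lpSet_subset_c0Set {p : ℝ} (hp : 0 < p) : lpSet p ⊆ c0Set := by
  intro x hx
  have h := (Summable.tendsto_atTop_zero hx).rpow_const (p := p⁻¹) (Or.inr (by positivity))
  refine tendsto_zero_iff_norm_tendsto_zero.2 ?_
  rw [Real.zero_rpow (inv_ne_zero hp.ne')] at h
  exact h.congr fun m => Real.rpow_rpow_inv (norm_nonneg _) hp.ne'

/-- The position of a space in the chain. -/
def ChainIdx.rank : ChainIdx → ℕ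
  | .c00 => 0
  | .Ainf => 1
  | .inter0 => 2
  | .la => 3
  | .interA => 4
  | .lb => 5
  | .interB => 6
  | .c0 => 7
  | .linf => 8
  | .Hd => 9
  | .all => 10

/-- The space at a given position of the chain. -/
def chainSet (a b : ℝ) : ℕ → Set (ℕ → ℂ)
  | 0 => c00Set
  | 1 => AinfSet
  | 2 => interLp 0
  | 3 => lpSet a
  | 4 => interLp a
  | 5 => lpSet b
  | 6 => interLp b
  | 7 => c0Set
  | 8 => linfSet
  | 9 => HdSet
  | _ => Set.univ

lemma chainCarrier_eq_chainSet (a b : ℝ) (i : ChainIdx) :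
    chainCarrier a b i = chainSet a b i.rank := by
  cases i <;> rfl

lemma lpSet_subset_interLp {p : ℝ} (hp : 0 < p) : lpSet p ⊆ interLp p := fun _ hx =>
  Set.mem_iInter₂.2 fun _ hq => lpSet_mono hp (le_of_lt hq) hx

lemma interLp_subset_lpSet {p q : ℝ} (hpq : p < q) : interLp p ⊆ lpSet q := fun _ hx =>
  Set.mem_iInter₂.1 hx q hpq

lemma monotone_chainSet {a b : ℝ} (ha : 0 < a) (hab : a < b) : Monotone (chainSet a b) := by
  refine monotone_nat_of_le_succ fun n => ?_
  match n with
  | 0 => exact isSolid_AinfSubmodule.finite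
  | 1 => exact AinfSet_subset_interLp_zero
  | 2 => exact interLp_subset_lpSet ha
  | 3 => exact lpSet_subset_interLp ha
  | 4 => exact interLp_subset_lpSet hab
  | 5 => exact lpSet_subset_interLp (ha.trans hab)
  | 6 => exact Set.Subset.trans (interLp_subset_lpSet (lt_add_one b)) (lpSet_subset_c0Set (by linarith))
  | 7 => exact c0Set_subset_linfSet
  | 8 => exact linfSet_subset_holoSubmodule.trans holoSubmodule_subset_HdSet
  | _ + 9 => exact Set.subset_univ _

lemma exists_chainSet_pred {a b : ℝ} (ha : 0 < a) (hab : a < b) {i j : ChainIdx}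
    (h : chainCarrier a b i ⊂ chainCarrier a b j) :
    ∃ n, j.rank = n + 1 ∧ chainCarrier a b i ⊆ chainSet a b n := by
  rw [chainCarrier_eq_chainSet, chainCarrier_eq_chainSet] at h
  have hmono := monotone_chainSet ha hab
  have hlt : i.rank < j.rank := hmono.reflect_lt h
  refine ⟨j.rank - 1, by omega, ?_⟩
  rw [chainCarrier_eq_chainSet]
  exact hmono (by omega)

lemma hasGenericFamily_chain {a b : ℝ} (ha : 0 < a) (hab : a < b) {j : ChainIdx} {n : ℕ}
    (hj : j.rank = n + 1) (hlinf : j ≠ .linf) :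
    HasGenericFamily (chainCarrier a b j) (chainSet a b n) (chainTopology a b j) := by
  cases j <;> cases hj
  · exact hasGenericFamily_AinfSet
  · exact hasGenericFamily_interLp_zero
  · exact hasGenericFamily_lpSet_interLp le_rfl ha
  · exact hasGenericFamily_interLp_lpSet ha
  · exact hasGenericFamily_lpSet_interLp ha.le hab
  · exact hasGenericFamily_interLp_lpSet (ha.trans hab)
  · exact hasGenericFamily_c0Set (ha.trans hab)
  · exact absurd rfl hlinf
  · exact hasGenericFamily_HdSet
  · exact hasGenericFamily_univ

/-- Fix reals `0 < a < b` and let `Y ⊊ X` be any two spaces of the chain (★) with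
`X ≠ ℓ^∞`. Then there are continuum many linearly independent dense subspaces
`F^k` of `X` such that the span of `⋃_k F^k` is contained in `(X \ Y) ∪ {0}`;
in particular there is uncountably infinite algebraic genericity for `X \ Y` in `X`. -/
theorem statement3 (a b : ℝ) (ha : 0 < a) (hab : a < b) (i j : ChainIdx)
    (hYX : chainCarrier a b i ⊂ chainCarrier a b j)
    (hXlinf : chainCarrier a b j ≠ linfSet) :
    ∃ (I : Type) (F : I → Submodule ℂ (ℕ → ℂ)),
      Cardinal.mk I = Cardinal.continuum ∧
      (∀ k, (F k : Set (ℕ → ℂ)) ⊆ chainCarrier a b j) ∧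
      (∀ k, @Dense ↥(chainCarrier a b j) (chainTopology a b j)
        (Subtype.val ⁻¹' (F k : Set (ℕ → ℂ)))) ∧
      (∀ (J : Finset I) (v : I → (ℕ → ℂ)), (∀ k ∈ J, v k ∈ F k) →
        (∑ k ∈ J, v k) = 0 → ∀ k ∈ J, v k = 0) ∧
      (∀ v : ℕ → ℂ, v ∈ (⨆ k, F k : Submodule ℂ (ℕ → ℂ)) → v ≠ 0 →
        v ∈ chainCarrier a b j ∧ v ∉ chainCarrier a b i) := by
  obtain ⟨n, hn, hsub⟩ := exists_chainSet_pred ha hab hYX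
  refine (hasGenericFamily_chain ha hab hn ?_).mono hsub
  rintro rfl
  exact hXlinf rfl
end
end

section
/- There exist a set I with card(I) = 𝔠 and a linearly independent family (F^k)_{k∈I} of closed infinite-dimensional vector subspaces of ℓ^∞ with F^k ⊆ (ℓ^∞ \ c₀) ∪ {0} for every k ∈ I. -/
open Filter Topology

noncomputable section

/-- Bounded sequences that, along each block `j ↦ Nat.pair i j`, are a multiple of `j ↦ z ^ j`. -/
def geomBlocks (z : Circle) : Submodule ℂ (ℕ → ℂ) where
  carrier := {v | v ∈ linfSet ∧ ∀ i j, v (Nat.pair i j) = v (Nat.pair i 0) * (z : ℂ) ^ j}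
  add_mem' := by
    rintro a b ⟨⟨C, hC⟩, ha⟩ ⟨⟨D, hD⟩, hb⟩
    refine ⟨⟨C + D, fun n => (norm_add_le _ _).trans (add_le_add (hC n) (hD n))⟩, fun i j => ?_⟩
    rw [Pi.add_apply, Pi.add_apply, ha i j, hb i j, add_mul]
  zero_mem' := ⟨⟨0, by simp⟩, by simp⟩
  smul_mem' := by
    rintro c a ⟨⟨C, hC⟩, ha⟩
    refine ⟨⟨‖c‖ * C, fun n => ?_⟩, fun i j => ?_⟩
    · rw [Pi.smul_apply, norm_smul]
      exact mul_le_mul_of_nonneg_left (hC n) (norm_nonneg c)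
    · rw [Pi.smul_apply, Pi.smul_apply, ha i j, smul_mul_assoc]

lemma geomBlocks_eq_zero {z : Circle} {v : ℕ → ℂ} (hv : v ∈ geomBlocks z)
    (h : ∀ i, v (Nat.pair i 0) = 0) : v = 0 := by
  ext n
  rw [← Nat.pair_unpair n, hv.2, h, zero_mul, Pi.zero_apply]

lemma norm_sub_le_dsup {x y : ℕ → ℂ} (hx : x ∈ linfSet) (hy : y ∈ linfSet) (n : ℕ) :
    ‖x n - y n‖ ≤ dsup x y := by
  obtain ⟨C, hC⟩ := hx
  obtain ⟨D, hD⟩ := hy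
  refine le_ciSup (f := fun n => ‖x n - y n‖) ⟨C + D, ?_⟩ n
  rintro _ ⟨m, rfl⟩
  exact (norm_sub_le _ _).trans (add_le_add (hC m) (hD m))

lemma isClosed_geomBlocks (z : Circle) :
    @IsClosed ↥linfSet (topOfDist fun x y => dsup x.1 y.1)
      (Subtype.val ⁻¹' (geomBlocks z : Set (ℕ → ℂ))) := by
  let : TopologicalSpace ↥linfSet := topOfDist fun x y => dsup x.1 y.1
  rw [← isOpen_compl_iff, isOpen_iff_forall_mem_open]
  intro x hx
  obtain ⟨i, j, hij⟩ :
      ∃ i j, x.1 (Nat.pair i j) ≠ x.1 (Nat.pair i 0) * (z : ℂ) ^ j := by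
    by_contra! h
    exact hx ⟨x.2, h⟩
  have hpos : 0 < ‖x.1 (Nat.pair i j) - x.1 (Nat.pair i 0) * (z : ℂ) ^ j‖ :=
    norm_pos_iff.2 (sub_ne_zero.2 hij)
  set δ := ‖x.1 (Nat.pair i j) - x.1 (Nat.pair i 0) * (z : ℂ) ^ j‖ with hδ
  refine ⟨{y | dsup x.1 y.1 < δ / 2}, fun y hy hyF => ?_,
    TopologicalSpace.isOpen_generateFrom_of_mem ⟨x, δ / 2, rfl⟩, ?_⟩
  · have hy : dsup x.1 y.1 < δ / 2 := hy
    have h₁ := norm_sub_le_dsup x.2 y.2 (Nat.pair i j)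
    have h₂ := norm_sub_le_dsup x.2 y.2 (Nat.pair i 0)
    have h₃ : δ ≤ ‖x.1 (Nat.pair i j) - y.1 (Nat.pair i j)‖ +
        ‖x.1 (Nat.pair i 0) - y.1 (Nat.pair i 0)‖ := by
      calc δ = ‖(x.1 (Nat.pair i j) - y.1 (Nat.pair i j)) -
              (x.1 (Nat.pair i 0) - y.1 (Nat.pair i 0)) * (z : ℂ) ^ j‖ := by
            rw [hδ, hyF.2 i j]
            ring_nf
        _ ≤ _ := norm_sub_le _ _
        _ = _ := by rw [norm_mul, norm_pow, Circle.norm_coe, one_pow, mul_one]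
    linarith
  · change dsup x.1 x.1 < δ / 2
    simpa [dsup] using hpos

lemma not_finiteDimensional_geomBlocks (z : Circle) :
    ¬ FiniteDimensional ℂ (geomBlocks z) := by
  intro hfin
  let b : ℕ → geomBlocks z := fun m =>
    ⟨fun n => if (Nat.unpair n).1 = m then (z : ℂ) ^ (Nat.unpair n).2 else 0,
      ⟨1, fun n => by dsimp only; split_ifs <;> simp [Circle.norm_coe]⟩, fun i j => by simp⟩
  let f : geomBlocks z →ₗ[ℂ] (ℕ → ℂ) :=
    (LinearMap.funLeft ℂ ℂ fun i => Nat.pair i 0) ∘ₗ (geomBlocks z).subtype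
  have hb : LinearIndependent ℂ b := by
    refine LinearIndependent.of_comp f ?_
    convert Pi.linearIndependent_single_one ℕ ℂ using 1
    ext m i
    simp [f, b, LinearMap.funLeft_apply, Pi.single_apply]
  exact not_finite_iff_infinite.2 (inferInstance : Infinite ℕ) hb.finite

lemma linearIndependent_circle_pow :
    LinearIndependent ℂ fun (z : Circle) (j : ℕ) => (z : ℂ) ^ j := by
  have h := (linearIndependent_monoidHom (Multiplicative ℕ) ℂ).comp
    (fun z : Circle => powersHom ℂ (z : ℂ))
    (fun z w h => Circle.ext ((powersHom ℂ).injective h))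
  exact h

lemma geomBlocks_sum_eq_zero (J : Finset Circle) (v : Circle → ℕ → ℂ)
    (hv : ∀ z ∈ J, v z ∈ geomBlocks z) (hsum : ∑ z ∈ J, v z = 0) :
    ∀ z ∈ J, v z = 0 := by
  refine fun z hz => geomBlocks_eq_zero (hv z hz) fun i => ?_
  refine linearIndependent_iff'.1 linearIndependent_circle_pow J
    (fun w => v w (Nat.pair i 0)) ?_ z hz
  ext j
  have hj := congrFun hsum (Nat.pair i j)
  rw [Finset.sum_apply] at hj ⊢
  exact (Finset.sum_congr rfl fun w hw => ((hv w hw).2 i j).symm).trans hj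

lemma geomBlocks_notMem_c0Set {z : Circle} {v : ℕ → ℂ} (hv : v ∈ geomBlocks z) (h0 : v ≠ 0) :
    v ∉ c0Set := by
  refine fun hc => h0 (geomBlocks_eq_zero hv fun i => ?_)
  have hpair : Tendsto (Nat.pair i) atTop atTop :=
    tendsto_atTop_mono (Nat.right_le_pair i) tendsto_id
  have hlim : Tendsto (fun j => ‖v (Nat.pair i j)‖) atTop (𝓝 0) := by
    simpa using (Tendsto.comp hc hpair).norm
  have hconst : (fun j => ‖v (Nat.pair i j)‖) = fun _ => ‖v (Nat.pair i 0)‖ := by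
    ext j
    rw [hv.2 i j, norm_mul, norm_pow, Circle.norm_coe, one_pow, mul_one]
  rw [hconst] at hlim
  exact norm_eq_zero.1 (tendsto_nhds_unique tendsto_const_nhds hlim)

lemma mk_circle : Cardinal.mk Circle = Cardinal.continuum := by
  rw [Cardinal.mk_congr Circle.argEquiv, Cardinal.mk_Ioc_real]
  linarith [Real.pi_pos]

/-- There are continuum many linearly independent closed infinite-dimensional vector
subspaces `F^k` of `ℓ^∞` (with the sup metric) with `F^k ⊆ (ℓ^∞ \ c₀) ∪ {0}`
for every `k`. -/
theorem statement13 :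
    ∃ (I : Type) (F : I → Submodule ℂ (ℕ → ℂ)),
      Cardinal.mk I = Cardinal.continuum ∧
      (∀ k, (F k : Set (ℕ → ℂ)) ⊆ linfSet) ∧
      (∀ k, @IsClosed ↥linfSet (topOfDist fun x y => dsup x.1 y.1)
        (Subtype.val ⁻¹' (F k : Set (ℕ → ℂ)))) ∧
      (∀ k, ¬ FiniteDimensional ℂ (F k)) ∧
      (∀ (J : Finset I) (v : I → (ℕ → ℂ)), (∀ k ∈ J, v k ∈ F k) →
        (∑ k ∈ J, v k) = 0 → ∀ k ∈ J, v k = 0) ∧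
      (∀ k, ∀ v ∈ F k, v ≠ 0 → v ∉ c0Set) := by
  exact ⟨Circle, geomBlocks, mk_circle, fun _ _ hv => hv.1, isClosed_geomBlocks,
    not_finiteDimensional_geomBlocks, geomBlocks_sum_eq_zero,
    fun _ _ hv => geomBlocks_notMem_c0Set hv⟩

end
end

section
/- In the space ℂ^{ℕ₀} of all complex sequences with the product topology, there exist a set I with card(I) = 𝔠 and a linearly independent family (F^k)_{k∈I} of closed infinite-dimensional vector subspaces of ℂ^{ℕ₀} with F^k ⊆ (ℂ^{ℕ₀} \ ℓ^∞) ∪ {0} for every k ∈ I. -/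
open Filter Topology

/-- The sequences which, read along the pairing `ℕ × ℕ ≃ ℕ`, are geometric with ratio `r`
on every row. -/
def geometricRows (r : ℂ) : Submodule ℂ (ℕ → ℂ) where
  carrier := {x | ∀ m n, x (Nat.pair m n) = r ^ n * x (Nat.pair m 0)}
  add_mem' hx hy m n := by simp only [Pi.add_apply, hx m n, hy m n, mul_add]
  zero_mem' m n := by simp
  smul_mem' c x hx m n := by simp only [Pi.smul_apply, hx m n, smul_eq_mul]; ring

theorem mem_geometricRows {r : ℂ} {x : ℕ → ℂ} :
    x ∈ geometricRows r ↔ ∀ m n, x (Nat.pair m n) = r ^ n * x (Nat.pair m 0) :=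
  Iff.rfl

theorem isClosed_geometricRows (r : ℂ) : IsClosed (geometricRows r : Set (ℕ → ℂ)) := by
  have h : (geometricRows r : Set (ℕ → ℂ)) =
      ⋂ m, ⋂ n, {x | x (Nat.pair m n) = r ^ n * x (Nat.pair m 0)} := by
    ext x
    simp [mem_geometricRows]
  rw [h]
  exact isClosed_iInter fun m => isClosed_iInter fun n =>
    isClosed_eq (by fun_prop) (by fun_prop)

/-- The sequence in `geometricRows r` whose rows start with the given values. -/
def geometricRowsOfInitial (r : ℂ) : (ℕ → ℂ) →ₗ[ℂ] geometricRows r where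
  toFun c := ⟨fun i => r ^ (Nat.unpair i).2 * c (Nat.unpair i).1, fun m n => by simp⟩
  map_add' c d := by ext i; simp [mul_add]
  map_smul' a c := by ext i; simp; ring

theorem geometricRowsOfInitial_injective (r : ℂ) :
    Function.Injective (geometricRowsOfInitial r) := by
  intro c d h
  ext m
  have := congrFun (congrArg Subtype.val h) (Nat.pair m 0)
  simpa [geometricRowsOfInitial] using this

theorem not_finiteDimensional_geometricRows (r : ℂ) :
    ¬ FiniteDimensional ℂ (geometricRows r) := by
  intro h
  have hfin : FiniteDimensional ℂ (ℕ → ℂ) :=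
    Module.Finite.of_injective _ (geometricRowsOfInitial_injective r)
  exact not_finite_iff_infinite.mpr (inferInstance : Infinite ℕ)
    (Pi.linearIndependent_single_one ℕ ℂ).finite_of_isNoetherian

theorem eq_zero_of_mem_geometricRows {r : ℂ} {x : ℕ → ℂ} (hx : x ∈ geometricRows r)
    (h : ∀ m, x (Nat.pair m 0) = 0) : x = 0 := by
  ext i
  rw [← Nat.pair_unpair i, mem_geometricRows.mp hx, h, mul_zero, Pi.zero_apply]

theorem linearIndependent_pow_sequences :
    LinearIndependent ℂ (fun (r : ℂ) (n : ℕ) => r ^ n) := by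
  have h := (linearIndependent_monoidHom (Multiplicative ℕ) ℂ).comp (powersHom ℂ)
    (powersHom ℂ).injective
  exact h

theorem notMem_linfSet_of_mem_geometricRows {r : ℂ} (hr : 1 < ‖r‖) {x : ℕ → ℂ}
    (hx : x ∈ geometricRows r) (hx0 : x ≠ 0) : x ∉ linfSet := by
  rintro ⟨C, hC⟩
  refine hx0 (eq_zero_of_mem_geometricRows hx fun m => ?_)
  by_contra hm
  have hpos : 0 < ‖x (Nat.pair m 0)‖ := norm_pos_iff.mpr hm
  obtain ⟨n, hn⟩ := pow_unbounded_of_one_lt (C / ‖x (Nat.pair m 0)‖) hr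
  have h := hC (Nat.pair m n)
  rw [mem_geometricRows.mp hx m n, norm_mul, norm_pow] at h
  exact absurd h (not_le.mpr ((div_lt_iff₀ hpos).mp hn))

theorem eq_zero_of_sum_geometricRows_eq_zero {I : Type*} {r : I → ℂ}
    (hr : Function.Injective r) (J : Finset I) (v : I → ℕ → ℂ)
    (hv : ∀ k ∈ J, v k ∈ geometricRows (r k)) (hsum : ∑ k ∈ J, v k = 0) :
    ∀ k ∈ J, v k = 0 := by
  intro k hk
  refine eq_zero_of_mem_geometricRows (hv k hk) fun m => ?_
  refine linearIndependent_iff'.mp (linearIndependent_pow_sequences.comp r hr) J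
    (fun j => v j (Nat.pair m 0)) ?_ k hk
  ext n
  have h := congrFun hsum (Nat.pair m n)
  rw [Finset.sum_apply] at h ⊢
  rw [Pi.zero_apply] at h ⊢
  rw [← h]
  refine Finset.sum_congr rfl fun j hj => ?_
  rw [mem_geometricRows.mp (hv j hj) m n]
  exact mul_comm _ _

/-- In the space `ℂ^ℕ` of all complex sequences with the product topology, there are
continuum many linearly independent closed infinite-dimensional vector subspaces
`F^k` with `F^k ⊆ (ℂ^ℕ \ ℓ^∞) ∪ {0}` for every `k`. -/
theorem statement15 :
    ∃ (I : Type) (F : I → Submodule ℂ (ℕ → ℂ)),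
      Cardinal.mk I = Cardinal.continuum ∧
      (∀ k, IsClosed (F k : Set (ℕ → ℂ))) ∧
      (∀ k, ¬ FiniteDimensional ℂ (F k)) ∧
      (∀ (J : Finset I) (v : I → (ℕ → ℂ)), (∀ k ∈ J, v k ∈ F k) →
        (∑ k ∈ J, v k) = 0 → ∀ k ∈ J, v k = 0) ∧
      (∀ k, ∀ v ∈ F k, v ≠ 0 → v ∉ linfSet) := by
  refine ⟨Set.Ioi (1 : ℝ), fun k => geometricRows ((k : ℝ) : ℂ), Cardinal.mk_Ioi_real 1,
    fun _ => isClosed_geometricRows _, fun _ => not_finiteDimensional_geometricRows _,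
    eq_zero_of_sum_geometricRows_eq_zero
      (Complex.ofReal_injective.comp Subtype.val_injective),
    fun k v hv hv0 => notMem_linfSet_of_mem_geometricRows ?_ hv hv0⟩
  rw [Complex.norm_real]
  exact lt_of_lt_of_le k.2 (le_abs_self _)
end
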